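/- If A and B are projections on a finite-dimensional Hilbert space with ‖AB‖ ≠ 1, then there is no density operator ρ with tr(ρA) = tr(ρB) = 1. -/

import Mathlib

open scoped ComplexOrder

/-- Operator norm of a matrix, viewed as an operator on Euclidean space. -/
noncomputable def opNorm {N : ℕ} (A : Matrix (Fin N) (Fin N) ℂ) : ℝ :=
  ‖Matrix.toEuclideanCLM (𝕜 := ℂ) A‖

/-- An orthogonal projection. -/
def IsProjection {N : ℕ} (A : Matrix (Fin N) (Fin N) ℂ) : Prop :=
  A.IsHermitian ∧ A * A = A

/-- A density operator: positive semidefinite with trace one. -/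
def IsDensity {N : ℕ} (ρ : Matrix (Fin N) (Fin N) ℂ) : Prop :=
  ρ.PosSemidef ∧ ρ.trace = 1

open scoped MatrixOrder Matrix.Norms.L2Operator in
theorem Matrix.PosSemidef.exists_eq_conjTranspose_mul_self {N : ℕ} {ρ : Matrix (Fin N) (Fin N) ℂ}
    (hρ : ρ.PosSemidef) : ∃ C : Matrix (Fin N) (Fin N) ℂ, ρ = C.conjTranspose * C :=
  CStarAlgebra.nonneg_iff_eq_star_mul_self.mp hρ.nonneg

/-- If `CᴴC` loses no trace when compressed by a projection `A`, then `A` fixes the range of `Cᴴ`. -/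
theorem IsProjection.mul_conjTranspose_eq_of_trace_eq {N : ℕ} {A C : Matrix (Fin N) (Fin N) ℂ}
    (hA : IsProjection A) (h : (C.conjTranspose * C * A).trace = (C.conjTranspose * C).trace) :
    A * C.conjTranspose = C.conjTranspose := by
  have hz : ((C * (1 - A)).conjTranspose * (C * (1 - A))).trace = 0 := by
    have hQ : (1 - A) * (1 - A) = 1 - A := by
      simp [mul_sub, sub_mul, hA.2]
    rw [Matrix.conjTranspose_mul, Matrix.conjTranspose_sub, Matrix.conjTranspose_one, hA.1.eq,
      Matrix.mul_assoc, Matrix.trace_mul_comm, ← Matrix.mul_assoc, Matrix.mul_assoc, hQ,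
      Matrix.mul_sub, Matrix.mul_one, Matrix.trace_sub, h, sub_self]
  rw [Matrix.trace_conjTranspose_mul_self_eq_zero_iff, Matrix.mul_sub, Matrix.mul_one,
    sub_eq_zero] at hz
  simpa [Matrix.conjTranspose_mul, hA.1.eq] using (congrArg Matrix.conjTranspose hz).symm

theorem opNorm_mul_le {N : ℕ} (A B : Matrix (Fin N) (Fin N) ℂ) :
    opNorm (A * B) ≤ opNorm A * opNorm B := by
  simpa only [opNorm, map_mul] using norm_mul_le _ _

theorem IsProjection.opNorm_le_one {N : ℕ} {A : Matrix (Fin N) (Fin N) ℂ}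
    (hA : IsProjection A) : opNorm A ≤ 1 := by
  have hs : IsStarProjection (Matrix.toEuclideanCLM (𝕜 := ℂ) A) :=
    IsStarProjection.map ⟨hA.2, hA.1⟩ _
  exact hs.norm_le

/-- If ‖AB‖ ≠ 1 then no state is perfectly localized with respect to both A and B. -/
theorem no_joint_localization {N : ℕ} (A B : Matrix (Fin N) (Fin N) ℂ)
    (hA : IsProjection A) (hB : IsProjection B) (hAB : opNorm (A * B) ≠ 1) :
    ¬ ∃ ρ : Matrix (Fin N) (Fin N) ℂ, IsDensity ρ ∧
      (ρ * A).trace = 1 ∧ (ρ * B).trace = 1 := by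
  rintro ⟨ρ, ⟨hρ, htr⟩, hρA, hρB⟩
  obtain ⟨C, rfl⟩ := hρ.exists_eq_conjTranspose_mul_self
  have hCA := hA.mul_conjTranspose_eq_of_trace_eq (hρA.trans htr.symm)
  have hCB := hB.mul_conjTranspose_eq_of_trace_eq (hρB.trans htr.symm)
  have hC : 0 < opNorm C.conjTranspose := by
    refine norm_pos_iff.mpr fun h => ?_
    have h0 : C.conjTranspose = 0 :=
      (map_eq_zero_iff _ (Matrix.toEuclideanCLM (n := Fin N) (𝕜 := ℂ)).injective).mp h
    simp [h0] at htr
  refine hAB (le_antisymm ?_ ?_)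
  · exact (opNorm_mul_le A B).trans
      (mul_le_one₀ hA.opNorm_le_one (norm_nonneg _) hB.opNorm_le_one)
  · have h := opNorm_mul_le (A * B) C.conjTranspose
    rw [Matrix.mul_assoc, hCB, hCA] at h
    exact (le_mul_iff_one_le_left hC).mp h
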